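/- arXiv:2311.06489 — 2 statements merged into one kernel-verified Lean document; each statement's English description precedes it below -/
import Mathlib

section
/- Let Γ be a lattice in ℝ^n and f : ℝ^n → ℂ an L¹-function with Fourier transform f̂(ξ) = ∫_{ℝ^n} f(x) e^{−2πi⟨x,ξ⟩} dx. Suppose (i) the series Σ_{γ∈Γ} f(x+γ) converges absolutely for every x and defines a continuous function of x ∈ ℝ^n, and (ii) the series Σ_{γ*∈Γ*} f̂(γ*) converges absolutely. Then for all x ∈ ℝ^n: Σ_{γ∈Γ} f(x+γ) = (1/vol(ℝ^n/Γ)) Σ_{γ*∈Γ*} f̂(γ*) e^{2πi⟨x,γ*⟩}. (No continuity of f itself is assumed.) -/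
open scoped Real
open Complex Matrix MeasureTheory

/-- The half-open unit cube `∏ᵢ (kᵢ, kᵢ + 1]` at an integer point `k`. -/
def unitCube {ι : Type*} (k : ι → ℤ) : Set (ι → ℝ) :=
  {x | ∀ i, x i ∈ Set.Ioc (k i : ℝ) (k i + 1)}

lemma mem_unitCube_iff {ι : Type*} {k : ι → ℤ} {x : ι → ℝ} :
    x ∈ unitCube k ↔ k = fun i => ⌈x i⌉ - 1 := by
  rw [funext_iff]
  refine forall_congr' fun i => ?_
  rw [eq_sub_iff_add_eq, eq_comm, Int.ceil_eq_iff, Set.mem_Ioc]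
  push_cast
  simp

lemma measurableSet_unitCube {ι : Type*} [Fintype ι] (k : ι → ℤ) :
    MeasurableSet (unitCube k) :=
  MeasurableSet.univ_pi' fun _ => measurableSet_Ioc

lemma pairwise_disjoint_unitCube {ι : Type*} :
    Pairwise (Function.onFun Disjoint (unitCube (ι := ι))) := by
  intro k l hkl
  refine Set.disjoint_left.mpr fun x hk hl => hkl ?_
  rw [mem_unitCube_iff.mp hk, mem_unitCube_iff.mp hl]

lemma iUnion_unitCube {ι : Type*} : ⋃ k, unitCube (ι := ι) k = Set.univ :=
  Set.eq_univ_of_forall fun _ => Set.mem_iUnion.mpr ⟨_, mem_unitCube_iff.mpr rfl⟩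

lemma preimage_add_right_unitCube {ι : Type*} (k : ι → ℤ) :
    (fun x : ι → ℝ => x + fun i => (k i : ℝ)) ⁻¹' unitCube k = unitCube 0 := by
  ext x
  refine forall_congr' fun i => ?_
  simp [add_comm (k i : ℝ)]

lemma setIntegral_unitCube_eq_setIntegral_add {ι E : Type*} [Fintype ι] [NormedAddCommGroup E]
    [NormedSpace ℝ E] (h : (ι → ℝ) → E) (k : ι → ℤ) :
    ∫ x in unitCube k, h x = ∫ x in unitCube 0, h (x + fun i => (k i : ℝ)) := by
  rw [← preimage_add_right_unitCube k]
  exact ((measurePreserving_add_right volume _).setIntegral_preimage_emb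
    (MeasurableEquiv.addRight _).measurableEmbedding h _).symm

lemma hasSum_setIntegral_unitCube_add {ι E : Type*} [Fintype ι] [NormedAddCommGroup E]
    [NormedSpace ℝ E] {h : (ι → ℝ) → E} (hh : Integrable h) :
    HasSum (fun k : ι → ℤ => ∫ x in unitCube 0, h (x + fun i => (k i : ℝ))) (∫ x, h x) := by
  have := hasSum_integral_iUnion (f := h) (μ := volume) measurableSet_unitCube
    pairwise_disjoint_unitCube hh.integrableOn
  rwa [iUnion_unitCube, setIntegral_univ,
    funext (setIntegral_unitCube_eq_setIntegral_add h)] at this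

/-- The integral of an integrable function is the integral over the unit cube of its
`ℤ^ι`-periodization. -/
lemma setIntegral_unitCube_tsum_add {ι E : Type*} [Fintype ι] [NormedAddCommGroup E]
    [NormedSpace ℝ E] [CompleteSpace E] {h : (ι → ℝ) → E} (hh : Integrable h) :
    ∫ x in unitCube 0, ∑' k : ι → ℤ, h (x + fun i => (k i : ℝ)) = ∫ x, h x := by
  rw [← integral_tsum_of_summable_integral_norm
    (fun k => (hh.comp_add_right _).integrableOn)
    (hasSum_setIntegral_unitCube_add hh.norm).summable]
  exact (hasSum_setIntegral_unitCube_add hh).tsum_eq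

lemma mFourier_coe_eq_exp {ι : Type*} [Fintype ι] (m : ι → ℤ) (x : ι → ℝ) :
    UnitAddTorus.mFourier m (fun i => (x i : UnitAddCircle)) =
      Complex.exp (2 * Real.pi * I * ∑ j, (x j : ℂ) * (m j : ℂ)) := by
  simp only [UnitAddTorus.mFourier, ContinuousMap.coe_mk, fourier_coe_apply, Finset.mul_sum,
    Complex.exp_sum]
  refine Finset.prod_congr rfl fun i _ => ?_
  congr 1
  push_cast
  ring

/-- Poisson summation for the standard lattice `ℤ^ι`. -/
theorem hasSum_fourier_periodization {ι : Type*} [Fintype ι] {g : (ι → ℝ) → ℂ}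
    (hg : Integrable g)
    (hc : Continuous fun x : ι → ℝ => ∑' k : ι → ℤ, g (x + fun i => (k i : ℝ)))
    (hs : Summable fun m : ι → ℤ =>
      ∫ z : ι → ℝ, g z * Complex.exp (-(2 * Real.pi * I * ∑ j, (z j : ℂ) * (m j : ℂ))))
    (x : ι → ℝ) :
    HasSum (fun m : ι → ℤ =>
      (∫ z : ι → ℝ, g z * Complex.exp (-(2 * Real.pi * I * ∑ j, (z j : ℂ) * (m j : ℂ)))) *
        Complex.exp (2 * Real.pi * I * ∑ j, (x j : ℂ) * (m j : ℂ)))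
      (∑' k : ι → ℤ, g (x + fun i => (k i : ℝ))) := by
  set G : (ι → ℝ) → ℂ := fun x => ∑' k : ι → ℤ, g (x + fun i => (k i : ℝ)) with hG
  set q : (ι → ℝ) → UnitAddTorus ι := fun x i => (x i : UnitAddCircle) with hq
  have hper : ∀ a b, q a = q b → G a = G b := by
    intro a b hab
    have : ∀ i, ∃ l : ℤ, b i = a i + l := fun i => by
      have h0 : ((b i - a i : ℝ) : UnitAddCircle) = 0 := by
        rw [AddCircle.coe_sub, sub_eq_zero]
        exact (congrFun hab i).symm
      obtain ⟨l, hl⟩ := (AddCircle.coe_eq_zero_iff (1 : ℝ)).mp h0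
      exact ⟨l, by rw [zsmul_one] at hl; rw [hl]; ring⟩
    choose l hl using this
    rw [hG]
    dsimp only
    rw [← (Equiv.addLeft l).tsum_eq]
    refine tsum_congr fun k => congrArg g (funext fun i => ?_)
    simp [hl, add_assoc]
  have hqo : IsOpenQuotientMap q :=
    IsOpenQuotientMap.piMap fun _ => QuotientAddGroup.isOpenQuotientMap_mk
  obtain ⟨Φ, hΦ⟩ : ∃ Φ : C(UnitAddTorus ι, ℂ), ∀ y, Φ (q y) = G y := by
    have hlift : ∀ y, G (Function.surjInv hqo.surjective (q y)) = G y := fun y =>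
      hper _ _ (Function.surjInv_eq hqo.surjective _)
    refine ⟨⟨fun t => G (Function.surjInv hqo.surjective t), ?_⟩, hlift⟩
    rw [hqo.isQuotientMap.continuous_iff]
    exact hc.congr fun y => (hlift y).symm
  have hcoeff : ∀ m, UnitAddTorus.mFourierCoeff Φ m =
      ∫ z : ι → ℝ, g z * Complex.exp (-(2 * Real.pi * I * ∑ j, (z j : ℂ) * (m j : ℂ))) := by
    intro m
    have hexp : ∀ z : ι → ℝ, Complex.exp (-(2 * Real.pi * I * ∑ j, (z j : ℂ) * (m j : ℂ))) =
        UnitAddTorus.mFourier (-m) (q z) := fun z => by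
      rw [mFourier_coe_eq_exp]
      simp
    simp only [hexp]
    have hint : Integrable fun z => g z * UnitAddTorus.mFourier (-m) (q z) := by
      refine hg.mul_bdd (c := 1)
        (((UnitAddTorus.mFourier (-m)).continuous.comp hqo.continuous).aestronglyMeasurable)
        (.of_forall fun z => ?_)
      exact ((UnitAddTorus.mFourier (-m)).norm_coe_le_norm _).trans_eq UnitAddTorus.mFourier_norm
    rw [← setIntegral_unitCube_tsum_add hint, UnitAddTorus.mFourierCoeff_eq_integral Φ m 0]
    have hcube : {x : ι → ℝ | ∀ i, x i ∈ Set.Ioc ((0 : ι → ℝ) i) ((0 : ι → ℝ) i + 1)} =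
        unitCube 0 := by
      simp [unitCube]
    rw [hcube]
    congr 1
    ext y
    have hqk : ∀ k : ι → ℤ, q (y + fun i => (k i : ℝ)) = q y := fun k => funext fun i => by
      simp [hq]
    simp only [hqk, tsum_mul_right]
    rw [smul_eq_mul, mul_comm]
    exact congrArg (· * _) (hΦ y)
  have hsum : Summable (UnitAddTorus.mFourierCoeff Φ) := by
    simpa only [funext hcoeff] using hs
  have := UnitAddTorus.hasSum_mFourier_series_apply_of_summable hsum (q x)
  rw [hΦ] at this
  simpa only [hcoeff, smul_eq_mul, hq, mFourier_coe_eq_exp] using this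

lemma measurableEmbedding_toLin' {n : ℕ} {M : Matrix (Fin n) (Fin n) ℝ} (hM : M.det ≠ 0) :
    MeasurableEmbedding (toLin' M) :=
  (toLin' M).continuous_of_finiteDimensional.measurableEmbedding
    (mulVec_injective_iff_isUnit.mpr ((isUnit_iff_isUnit_det M).mpr hM.isUnit))

lemma integrable_comp_vecMul {n : ℕ} {A : Matrix (Fin n) (Fin n) ℝ} (hA : A.det ≠ 0)
    {E : Type*} [NormedAddCommGroup E] {f : (Fin n → ℝ) → E} (hf : Integrable f) :
    Integrable fun y => f (y ᵥ* A) := by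
  have hA' : Aᵀ.det ≠ 0 := by rwa [det_transpose]
  have := (measurableEmbedding_toLin' hA').integrable_map_iff (g := f) (μ := volume)
  rw [Real.map_matrix_volume_pi_eq_smul_volume_pi hA'] at this
  simpa [Function.comp_def, mulVec_transpose] using
    this.mp (hf.smul_measure ENNReal.ofReal_ne_top)

lemma integral_comp_vecMul {n : ℕ} {A : Matrix (Fin n) (Fin n) ℝ} (hA : A.det ≠ 0)
    {E : Type*} [NormedAddCommGroup E] [NormedSpace ℝ E] (f : (Fin n → ℝ) → E) :
    ∫ y, f (y ᵥ* A) = |A.det|⁻¹ • ∫ z, f z := by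
  have hA' : Aᵀ.det ≠ 0 := by rwa [det_transpose]
  have := (measurableEmbedding_toLin' hA').integral_map (μ := volume) f
  rw [Real.map_matrix_volume_pi_eq_smul_volume_pi hA', integral_smul_measure] at this
  simpa [mulVec_transpose, abs_inv] using this.symm

/-- the Poisson summation formula for a lattice `Γ = ℤ^n A ⊆ ℝ^n`
(`A ∈ GL_n(ℝ)`, row-vector convention, `Γ* = ℤ^n ᵗA⁻¹`, `vol(ℝ^n/Γ) = |det A|`) and an
`L¹`-function `f : ℝ^n → ℂ`, assuming only
(i) `Σ_{γ∈Γ} f(x+γ)` converges absolutely for every `x` and is continuous in `x`, and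
(ii) `Σ_{γ*∈Γ*} f̂(γ*)` converges absolutely
(no continuity of `f` itself): for all `x ∈ ℝ^n`,
`Σ_{γ∈Γ} f(x+γ) = (1/vol(ℝ^n/Γ)) Σ_{γ*∈Γ*} f̂(γ*) e^{2qi⟨x,γ*⟩}`. -/
theorem poisson_summation_formula (n : ℕ) (A : Matrix (Fin n) (Fin n) ℝ) (hA : IsUnit A.det)
    (f : (Fin n → ℝ) → ℂ) (hf : Integrable f)
    (hi : (∀ x : Fin n → ℝ, Summable fun k : Fin n → ℤ =>
            ‖f (x + (fun i => (k i : ℝ)) ᵥ* A)‖) ∧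
          Continuous fun x : Fin n → ℝ => ∑' k : Fin n → ℤ, f (x + (fun i => (k i : ℝ)) ᵥ* A))
    (hii : Summable fun m : Fin n → ℤ =>
            ‖∫ z : Fin n → ℝ, f z * Complex.exp (-(2 * Real.pi * I *
              ∑ j, (z j : ℂ) * (((fun i => (m i : ℝ)) ᵥ* (Aᵀ)⁻¹) j : ℂ)))‖) :
    ∀ x : Fin n → ℝ,
      ∑' k : Fin n → ℤ, f (x + (fun i => (k i : ℝ)) ᵥ* A) =
        ((|A.det| : ℝ) : ℂ)⁻¹ *
          ∑' m : Fin n → ℤ,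
            (∫ z : Fin n → ℝ, f z * Complex.exp (-(2 * Real.pi * I *
              ∑ j, (z j : ℂ) * (((fun i => (m i : ℝ)) ᵥ* (Aᵀ)⁻¹) j : ℂ)))) *
            Complex.exp (2 * Real.pi * I *
              ∑ j, (x j : ℂ) * (((fun i => (m i : ℝ)) ᵥ* (Aᵀ)⁻¹) j : ℂ)) := by
  intro x
  have hdet : A.det ≠ 0 := hA.ne_zero
  have hpair : ∀ (y : Fin n → ℝ) (m : Fin n → ℤ),
      ∑ j, ((y ᵥ* A) j : ℂ) * (((fun i => (m i : ℝ)) ᵥ* (Aᵀ)⁻¹) j : ℂ) =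
        ∑ j, (y j : ℂ) * (m j : ℂ) := fun y m => by
    have h : (y ᵥ* A) ⬝ᵥ ((fun i => (m i : ℝ)) ᵥ* (Aᵀ)⁻¹) = y ⬝ᵥ fun i => (m i : ℝ) := by
      rw [← transpose_nonsing_inv, vecMul_transpose, dotProduct_mulVec, vecMul_vecMul,
        mul_nonsing_inv A hA, vecMul_one]
    simp only [dotProduct] at h
    exact_mod_cast congrArg (fun r : ℝ => (r : ℂ)) h
  have hcoeff : ∀ m : Fin n → ℤ,
      ∫ y : Fin n → ℝ, f (y ᵥ* A) *
          Complex.exp (-(2 * Real.pi * I * ∑ j, (y j : ℂ) * (m j : ℂ))) =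
        ((|A.det| : ℝ) : ℂ)⁻¹ * ∫ z : Fin n → ℝ, f z * Complex.exp (-(2 * Real.pi * I *
              ∑ j, (z j : ℂ) * (((fun i => (m i : ℝ)) ᵥ* (Aᵀ)⁻¹) j : ℂ))) := fun m => by
    have := integral_comp_vecMul hdet fun z => f z * Complex.exp (-(2 * Real.pi * I *
              ∑ j, (z j : ℂ) * (((fun i => (m i : ℝ)) ᵥ* (Aᵀ)⁻¹) j : ℂ)))
    simp only [hpair] at this
    rw [this, Complex.real_smul, Complex.ofReal_inv]
  have hx : (x ᵥ* A⁻¹) ᵥ* A = x := by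
    rw [vecMul_vecMul, nonsing_inv_mul A hA, vecMul_one]
  have hcont : Continuous fun y : Fin n → ℝ =>
      ∑' k : Fin n → ℤ, f ((y + fun i => (k i : ℝ)) ᵥ* A) := by
    simp only [add_vecMul]
    exact hi.2.comp (g := fun z => ∑' k : Fin n → ℤ, f (z + (fun i => (k i : ℝ)) ᵥ* A))
      (f := fun y => y ᵥ* A) (by fun_prop)
  have key := (hasSum_fourier_periodization (integrable_comp_vecMul hdet hf) hcont
    (by simpa only [hcoeff] using hii.of_norm.mul_left _) (x ᵥ* A⁻¹)).tsum_eq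
  simp only [hcoeff, add_vecMul, hx] at key
  simp only [← hpair (x ᵥ* A⁻¹), hx] at key
  rw [← key, ← tsum_mul_left]
  exact tsum_congr fun m => mul_assoc _ _ _
end

section
/- Let Γ be a sublattice of ℤ^n. For all (t_1,…,t_n) ∈ ℂ^n, x = (x_1,…,x_n) ∈ ℤ^n and y = (y_1,…,y_n) ∈ ℝ^n: Σ_{γ=(γ_j)∈Γ} (∏_{j=1}^n I_{x_j+γ_j}(t_j)) e^{2πi⟨y, x+γ⟩} = (1/vol(ℝ^n/Γ)) Σ_{γ*=(γ*_j)∈Γ*} (∏_{j=1}^n 1_{[-1/2,1/2]}(y_j−γ*_j) e^{t_j cos 2π(y_j−γ*_j)}) e^{2πi⟨x, γ*⟩}. -/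
open scoped Real
open Complex Matrix

/-- The modified Bessel function of the first kind with integer order,
`I_x(t) = (1/π) ∫₀^π e^{t cos θ} cos(xθ) dθ`. -/
noncomputable def besselI (x : ℝ) (t : ℂ) : ℂ :=
  (Real.pi : ℂ)⁻¹ * ∫ θ in (0:ℝ)..Real.pi, Complex.exp (t * Real.cos θ) * (Real.cos (x * θ) : ℂ)

/-- The rectangular function `1_{[-1/2,1/2]}`. -/
noncomputable def rect (x : ℝ) : ℝ :=
  if |x| < 1/2 then 1 else if |x| = 1/2 then 1/2 else 0

theorem summable_complex_mul_of_summable_norm {α β : Type*} {f : α → ℂ} {g : β → ℂ}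
    (hf : Summable fun i => ‖f i‖) (hg : Summable fun i => ‖g i‖) :
    Summable fun p : α × β => f p.1 * g p.2 :=
  summable_mul_of_summable_norm hf hg

/-- A finite product of absolutely convergent series is the series of products. -/
theorem hasSum_pi_prod {κ : Type*} {n : ℕ} {f : Fin n → κ → ℂ} {a : Fin n → ℂ}
    (hf : ∀ j, Summable fun i => ‖f j i‖) (ha : ∀ j, HasSum (f j) (a j)) :
    Summable (fun k : Fin n → κ => ‖∏ j, f j (k j)‖) ∧
      HasSum (fun k : Fin n → κ => ∏ j, f j (k j)) (∏ j, a j) := by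
  induction n with
  | zero =>
    refine ⟨(hasSum_fintype _).summable, ?_⟩
    simp
  | succ n ih =>
    obtain ⟨hs, hh⟩ := ih (f := fun j => f j.succ) (a := fun j => a j.succ)
      (fun j => hf j.succ) (fun j => ha j.succ)
    have key : ∀ p : κ × (Fin n → κ), ∏ j, f j (Fin.consEquiv (fun _ => κ) p j) =
        f 0 p.1 * ∏ j : Fin n, f j.succ (p.2 j) := fun p => by
      simp [Fin.prod_univ_succ]
    have hm : Summable fun p : κ × (Fin n → κ) => f 0 p.1 * ∏ j : Fin n, f j.succ (p.2 j) := by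
      have h := summable_complex_mul_of_summable_norm (hf 0) hs
      exact h
    constructor
    · rw [← (Fin.consEquiv fun _ => κ).summable_iff]
      refine hm.norm.congr fun p => ?_
      rw [Function.comp_apply, key]
    · rw [← (Fin.consEquiv fun _ => κ).hasSum_iff, Fin.prod_univ_succ]
      exact (HasSum.mul (ha 0) hh hm).congr_fun key

theorem hasSum_rect_sub_int (a : ℝ) : HasSum (fun w : ℤ => rect (a - w)) 1 := by
  set w₀ : ℤ := ⌊a + 1 / 2⌋ with hw
  have h1 : (w₀ : ℝ) ≤ a + 1 / 2 := Int.floor_le _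
  have h2 : a + 1 / 2 < w₀ + 1 := Int.lt_floor_add_one _
  have h : ∑ w ∈ ({w₀, w₀ - 1} : Finset ℤ), rect (a - w) = 1 := by
    rw [Finset.sum_pair (by omega)]
    push_cast
    rcases h1.eq_or_lt with h | h
    · have e1 : a - w₀ = -(1/2) := by linarith
      have e2 : a - (w₀ - 1) = 1/2 := by linarith
      rw [e1, e2]
      norm_num [rect, abs_of_pos]
    · have e1 : |a - w₀| < 1/2 := abs_lt.2 ⟨by linarith, by linarith⟩
      have e2 : 1/2 < |a - (w₀ - 1)| := lt_abs.2 (Or.inl (by linarith))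
      simp only [rect, if_pos e1, if_neg e2.not_gt, if_neg e2.ne']
      norm_num
  rw [← h]
  refine hasSum_sum_of_ne_finset_zero fun w hw' => ?_
  have e2 : 1/2 < |a - w| := by
    simp only [Finset.mem_insert, Finset.mem_singleton, not_or] at hw'
    rcases lt_trichotomy w w₀ with h | h | h
    · have : w + 2 ≤ w₀ := by omega
      have : (w : ℝ) + 2 ≤ w₀ := by exact_mod_cast this
      exact lt_abs.2 (Or.inl (by linarith))
    · exact absurd h hw'.1
    · have : w₀ + 1 ≤ w := h
      have : (w₀ : ℝ) + 1 ≤ w := by exact_mod_cast this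
      exact lt_abs.2 (Or.inr (by linarith))
  simp only [rect, if_neg e2.not_gt, if_neg e2.ne']

/-- The three-term recurrence for Bessel functions of integer order. -/
theorem besselI_int_mul (k : ℤ) (t : ℂ) :
    (k : ℂ) * besselI k t = t / 2 * (besselI (k - 1) t - besselI (k + 1) t) := by
  have hc : ∀ r : ℝ, IntervalIntegrable (fun θ : ℝ => Complex.exp (t * Real.cos θ) *
      (Real.cos (r * θ) : ℂ)) MeasureTheory.volume 0 π := fun r =>
    Continuous.intervalIntegrable (by fun_prop) _ _
  have hd : ∀ θ : ℝ, HasDerivAt (fun θ : ℝ => Complex.exp (t * Real.cos θ) * (Real.sin (k * θ) : ℂ))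
      ((k : ℂ) * (Complex.exp (t * Real.cos θ) * (Real.cos (k * θ) : ℂ)) -
        t / 2 * (Complex.exp (t * Real.cos θ) * (Real.cos ((k - 1) * θ) : ℂ) -
          Complex.exp (t * Real.cos θ) * (Real.cos ((k + 1) * θ) : ℂ))) θ := fun θ => by
    have h1 := (((Real.hasDerivAt_cos θ).ofReal_comp).const_mul t).cexp
    have h2 := ((Real.hasDerivAt_sin (k * θ)).comp θ
      ((hasDerivAt_id θ).const_mul (k : ℝ))).ofReal_comp
    refine (h1.mul h2).congr_deriv ?_
    simp only [sub_mul, add_mul, one_mul, Real.cos_add, Real.cos_sub, Function.comp]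
    push_cast
    simp
    ring
  have hi := intervalIntegral.integral_eq_sub_of_hasDerivAt (a := 0) (b := π) (fun θ _ => hd θ)
    (Continuous.intervalIntegrable (by fun_prop) _ _)
  rw [intervalIntegral.integral_sub ((hc _).const_mul _) (((hc _).sub (hc _)).const_mul _),
    intervalIntegral.integral_const_mul, intervalIntegral.integral_const_mul,
    intervalIntegral.integral_sub (hc _) (hc _)] at hi
  simp only [Real.sin_int_mul_pi, mul_zero, Real.sin_zero, Complex.ofReal_zero, sub_zero] at hi
  unfold besselI
  linear_combination (π : ℂ)⁻¹ * hi

theorem norm_besselI_le (x : ℝ) (t : ℂ) : ‖besselI x t‖ ≤ Real.exp ‖t‖ := by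
  have h := intervalIntegral.norm_integral_le_of_norm_le_const (a := 0) (b := π)
    (f := fun θ : ℝ => Complex.exp (t * Real.cos θ) * (Real.cos (x * θ) : ℂ))
    (C := Real.exp ‖t‖) fun θ _ => by
      rw [norm_mul, Complex.norm_real]
      refine (mul_le_of_le_one_right (norm_nonneg _) (Real.abs_cos_le_one _)).trans ?_
      refine (Complex.norm_exp_le_exp_norm _).trans (Real.exp_le_exp.2 ?_)
      rw [norm_mul, Complex.norm_real]
      exact mul_le_of_le_one_right (norm_nonneg _) (Real.abs_cos_le_one _)
  rw [sub_zero, abs_of_pos Real.pi_pos] at h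
  rw [besselI, norm_mul, norm_inv, Complex.norm_real, Real.norm_of_nonneg Real.pi_pos.le,
    inv_mul_le_iff₀ Real.pi_pos, mul_comm π]
  exact h

theorem exists_norm_sq_mul_besselI_le (t : ℂ) :
    ∃ C : ℝ, ∀ k : ℤ, (k : ℝ) ^ 2 * ‖besselI k t‖ ≤ C := by
  set M := Real.exp ‖t‖
  have hM : 0 ≤ M := (Real.exp_pos _).le
  have h1 : ∀ k : ℤ, ‖(k : ℂ) * besselI k t‖ ≤ ‖t‖ * M := fun k => by
    rw [besselI_int_mul, norm_mul, norm_div, Complex.norm_two]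
    have := (norm_sub_le _ _).trans (add_le_add (norm_besselI_le (k - 1) t) (norm_besselI_le (k + 1) t))
    calc _ ≤ ‖t‖ / 2 * (M + M) := by gcongr
      _ = _ := by ring
  refine ⟨‖t‖ / 2 * (‖t‖ * M + M + (‖t‖ * M + M)), fun k => ?_⟩
  have e : (k : ℂ) ^ 2 * besselI k t = t / 2 *
      ((((k - 1 : ℤ) : ℂ) * besselI (k - 1 : ℤ) t + besselI (k - 1 : ℤ) t) -
        (((k + 1 : ℤ) : ℂ) * besselI (k + 1 : ℤ) t - besselI (k + 1 : ℤ) t)) := by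
    have := besselI_int_mul k t
    push_cast
    linear_combination (k : ℂ) * this
  have e' : (k : ℝ) ^ 2 * ‖besselI k t‖ = ‖(k : ℂ) ^ 2 * besselI k t‖ := by
    rw [norm_mul, norm_pow, Complex.norm_intCast, sq_abs]
  rw [e', e, norm_mul, norm_div, Complex.norm_two]
  gcongr
  refine (norm_sub_le _ _).trans (add_le_add ((norm_add_le _ _).trans ?_) ((norm_sub_le _ _).trans ?_))
  · exact add_le_add (h1 _) (norm_besselI_le _ _)
  · exact add_le_add (h1 _) (norm_besselI_le _ _)

theorem summable_norm_besselI (t : ℂ) : Summable fun k : ℤ => ‖besselI k t‖ := by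
  obtain ⟨C, hC⟩ := exists_norm_sq_mul_besselI_le t
  refine Summable.of_norm_bounded_eventually
    ((Real.summable_one_div_int_pow (p := 2)).2 one_lt_two |>.mul_left C) ?_
  refine (Set.finite_singleton (0 : ℤ)).subset fun k hk => ?_
  by_contra h0
  refine hk ?_
  have h0 : (k : ℝ) ≠ 0 := by exact_mod_cast h0
  change ‖‖besselI k t‖‖ ≤ C * (1 / (k : ℝ) ^ 2)
  rw [norm_norm, mul_one_div, le_div_iff₀ (by positivity), mul_comm]
  exact hC k

instance fact_zero_lt_two_pi : Fact (0 < 2 * π) := ⟨Real.two_pi_pos⟩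

/-- The function `θ ↦ e^{t cos θ}` on the circle `ℝ/2πℤ`. -/
noncomputable def expMulCos (t : ℂ) : C(AddCircle (2 * π), ℂ) where
  toFun x := Complex.exp (t * (Real.Angle.cos x : ℝ))
  continuous_toFun := by
    have := Real.Angle.continuous_cos
    fun_prop

theorem fourierCoeff_expMulCos (t : ℂ) (k : ℤ) : fourierCoeff (expMulCos t) k = besselI k t := by
  have hf : Continuous fun θ : ℝ => Complex.exp (-(k * θ * I)) * Complex.exp (t * Real.cos θ) := by
    fun_prop
  rw [fourierCoeff_eq_intervalIntegral _ _ (-π)]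
  have h1 : ∀ θ : ℝ, fourier (-k) (θ : AddCircle (2 * π)) • expMulCos t θ =
      Complex.exp (-(k * θ * I)) * Complex.exp (t * Real.cos θ) := fun θ => by
    rw [fourier_coe_apply, smul_eq_mul]
    congr 2
    push_cast
    field_simp
  simp_rw [h1]
  rw [show -π + 2 * π = π by ring, ← intervalIntegral.integral_add_adjacent_intervals (b := 0)
    (hf.intervalIntegrable _ _) (hf.intervalIntegrable _ _)]
  have h2 := intervalIntegral.integral_comp_neg (a := 0) (b := π)
    fun θ : ℝ => Complex.exp (-(k * θ * I)) * Complex.exp (t * Real.cos θ)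
  rw [neg_zero] at h2
  rw [← h2, ← intervalIntegral.integral_add (Continuous.intervalIntegrable (by fun_prop) _ _)
    (hf.intervalIntegrable _ _), besselI]
  have h3 : ∀ θ : ℝ, Complex.exp (-(k * (-θ : ℝ) * I)) * Complex.exp (t * Real.cos (-θ)) +
      Complex.exp (-(k * θ * I)) * Complex.exp (t * Real.cos θ) =
      2 * (Complex.exp (t * Real.cos θ) * (Real.cos (k * θ) : ℂ)) := fun θ => by
    rw [Real.cos_neg]
    push_cast
    rw [show Complex.cos (k * θ) = (Complex.exp (k * θ * I) + Complex.exp (-(k * θ) * I)) / 2 from rfl]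
    ring_nf
  simp_rw [h3]
  rw [intervalIntegral.integral_const_mul, Complex.real_smul]
  push_cast
  ring

/-- The Fourier series of `u ↦ e^{t cos 2πu}` has the Bessel functions as coefficients. -/
theorem hasSum_besselI_mul_exp (t : ℂ) (u : ℝ) :
    HasSum (fun k : ℤ => besselI k t * Complex.exp (2 * π * I * (k * u)))
      (Complex.exp (t * Real.cos (2 * π * u))) := by
  have hs : Summable (fourierCoeff (expMulCos t)) := by
    simp_rw [funext (fourierCoeff_expMulCos t)]
    exact (summable_norm_besselI t).of_norm
  have h := has_pointwise_sum_fourier_series_of_summable hs ((2 * π * u : ℝ) : AddCircle (2 * π))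
  simp only [fourierCoeff_expMulCos, fourier_coe_apply, smul_eq_mul] at h
  refine h.congr_fun fun k => ?_
  congr 2
  push_cast
  field_simp

/-- Summation over a group, coset by coset along a subgroup of finite index. -/
theorem hasSum_of_quotient {M W : Type*} [AddCommGroup M] [AddCommGroup W] (L : W →+ M)
    (hL : Function.Injective L) [Fintype (M ⧸ L.range)] {f : M → ℂ} {a : M ⧸ L.range → ℂ}
    (h : ∀ q : M ⧸ L.range, HasSum (fun w => f (q.out + L w)) (a q)) : HasSum f (∑ q, a q) := by
  classical
  have h1 : ∀ q : M ⧸ L.range,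
      HasSum (fun m : M => if (m : M ⧸ L.range) = q then f m else 0) (a q) := fun q => by
    have hi : Function.Injective fun w => q.out + L w := (add_right_injective _).comp hL
    rw [← hi.hasSum_iff]
    · refine (h q).congr_fun fun w => ?_
      have : ((q.out + L w : M) : M ⧸ L.range) = q := by
        rw [QuotientAddGroup.mk_add, (QuotientAddGroup.eq_zero_iff (L w)).2
          (AddMonoidHom.mem_range.2 ⟨w, rfl⟩), add_zero, QuotientAddGroup.out_eq']
      simp only [Function.comp_apply, if_pos this]
    · intro m hm
      refine if_neg fun hq => hm ?_
      have : (q.out : M ⧸ L.range) = m := by rw [hq, QuotientAddGroup.out_eq']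
      obtain ⟨w, hw⟩ := QuotientAddGroup.eq.1 this
      exact ⟨w, by simp [hw]⟩
  refine (hasSum_sum fun q (_ : q ∈ Finset.univ) => h1 q).congr_fun fun m => ?_
  simp

/-- Orthogonality relation for a character that is trivial on a subgroup of finite index. -/
theorem sum_addChar_out {M : Type*} [AddCommGroup M] (N : AddSubgroup M) [Fintype (M ⧸ N)]
    (ψ : AddChar M ℂ) (hψ : ∀ m ∈ N, ψ m = 1) [Decidable (∀ m, ψ m = 1)] :
    ∑ q : M ⧸ N, ψ q.out = if ∀ m, ψ m = 1 then (Nat.card (M ⧸ N) : ℂ) else 0 := by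
  classical
  have hmk : ∀ m m' : M, (m : M ⧸ N) = m' → ψ m = ψ m' := fun m m' h => by
    have := hψ _ (QuotientAddGroup.eq.1 h)
    rw [AddChar.map_add_eq_mul] at this
    have h2 : ψ m * ψ (-m) = 1 := by
      rw [← AddChar.map_add_eq_mul, add_neg_cancel, AddChar.map_zero_eq_one]
    linear_combination ψ m' * h2 - ψ m * this
  let χ : AddChar (M ⧸ N) ℂ :=
    { toFun := fun q => ψ q.out
      map_zero_eq_one' := by
        rw [hmk _ 0 (by rw [QuotientAddGroup.out_eq']; rfl), AddChar.map_zero_eq_one]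
      map_add_eq_mul' := fun p q => by
        rw [← AddChar.map_add_eq_mul]
        exact hmk _ _ (by simp only [QuotientAddGroup.mk_add, QuotientAddGroup.out_eq']) }
  have hχ : χ = 0 ↔ ∀ m, ψ m = 1 := by
    rw [DFunLike.ext_iff]
    constructor
    · intro h m
      rw [← hmk _ m (QuotientAddGroup.out_eq' (m : M ⧸ N))]
      exact h m
    · exact fun h q => h _
  have := AddChar.sum_eq_ite χ
  simp only [hχ, ← Nat.card_eq_fintype_card] at this
  exact this

theorem hasSum_prod_rect_mul_exp {n : ℕ} (t : Fin n → ℂ) (u : Fin n → ℝ) :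
    HasSum (fun w : Fin n → ℤ => ∏ j, ((rect (u j - w j) : ℂ) *
        Complex.exp (t j * Real.cos (2 * π * (u j - w j)))))
      (∏ j, Complex.exp (t j * Real.cos (2 * π * u j))) := by
  have h : ∀ j, HasSum (fun w : ℤ => (rect (u j - w) : ℂ) *
      Complex.exp (t j * Real.cos (2 * π * (u j - w))))
      (Complex.exp (t j * Real.cos (2 * π * u j))) := fun j => by
    have h1 := (Complex.hasSum_ofReal.2 (hasSum_rect_sub_int (u j))).mul_right
      (Complex.exp (t j * Real.cos (2 * π * u j)))
    rw [Complex.ofReal_one, one_mul] at h1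
    refine h1.congr_fun fun w => ?_
    rw [mul_sub, mul_comm (2 * π) (w : ℝ), Real.cos_sub_int_mul_two_pi]
  exact (hasSum_pi_prod (f := fun j (w : ℤ) => (rect (u j - w) : ℂ) *
      Complex.exp (t j * Real.cos (2 * π * (u j - w)))) (fun j => (h j).summable.norm) h).2

theorem hasSum_prod_besselI_mul_exp {n : ℕ} (t : Fin n → ℂ) (u : Fin n → ℝ) :
    HasSum (fun z : Fin n → ℤ => (∏ j, besselI (z j) (t j)) *
        Complex.exp (2 * π * I * ∑ j, (z j : ℂ) * u j))
      (∏ j, Complex.exp (t j * Real.cos (2 * π * u j))) := by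
  refine (hasSum_pi_prod (f := fun j (k : ℤ) => besselI k (t j) *
    Complex.exp (2 * π * I * (k * u j))) (fun j => (hasSum_besselI_mul_exp _ _).summable.norm)
    fun j => hasSum_besselI_mul_exp _ _).2.congr_fun fun z => ?_
  rw [Finset.prod_mul_distrib, Finset.mul_sum, Complex.exp_sum]

/-- The dual lattice vector with coordinates `m`. -/
noncomputable def dualVec {n : ℕ} (A : Matrix (Fin n) (Fin n) ℝ) (m : Fin n → ℤ) : Fin n → ℝ :=
  (fun i => (m i : ℝ)) ᵥ* (Aᵀ)⁻¹

theorem dualVec_add {n : ℕ} (A : Matrix (Fin n) (Fin n) ℝ) (m m' : Fin n → ℤ) :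
    dualVec A (m + m') = dualVec A m + dualVec A m' := by
  rw [dualVec, dualVec, dualVec, ← Matrix.add_vecMul]
  congr 1
  ext i
  simp

theorem dualVec_mulVec {n : ℕ} (B : Matrix (Fin n) (Fin n) ℤ)
    (hB : IsUnit (B.map (Int.cast : ℤ → ℝ)).det) (w : Fin n → ℤ) :
    dualVec (B.map (Int.cast : ℤ → ℝ)) (B *ᵥ w) = fun i => (w i : ℝ) := by
  have h : (fun i => ((B *ᵥ w) i : ℝ)) = (fun i => (w i : ℝ)) ᵥ* (B.map (Int.cast : ℤ → ℝ))ᵀ := by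
    ext i
    simp [Matrix.mulVec, Matrix.vecMul, dotProduct, mul_comm]
  rw [dualVec, h, Matrix.vecMul_vecMul, Matrix.mul_nonsing_inv _ (by rwa [Matrix.det_transpose]),
    Matrix.vecMul_one]

theorem dotProduct_dualVec {n : ℕ} (A : Matrix (Fin n) (Fin n) ℝ) (hA : IsUnit A.det)
    (v : Fin n → ℝ) (m : Fin n → ℤ) :
    (v ᵥ* A) ⬝ᵥ dualVec A m = v ⬝ᵥ fun i => (m i : ℝ) := by
  rw [dualVec, ← Matrix.transpose_nonsing_inv, Matrix.vecMul_transpose, ← Matrix.dotProduct_mulVec,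
    Matrix.mulVec_mulVec, Matrix.mul_nonsing_inv _ hA, Matrix.one_mulVec]

/-- The character `m ↦ exp (2πi ⟨z, m (ᵗA)⁻¹⟩)` of `ℤ^n`. -/
noncomputable def dualChar {n : ℕ} (A : Matrix (Fin n) (Fin n) ℝ) (z : Fin n → ℤ) :
    AddChar (Fin n → ℤ) ℂ where
  toFun m := Complex.exp (2 * π * I * (((fun i => (z i : ℝ)) ⬝ᵥ dualVec A m : ℝ) : ℂ))
  map_zero_eq_one' := by
    have : dualVec A 0 = 0 := by simpa using dualVec_add A 0 0
    simp [this]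
  map_add_eq_mul' m m' := by
    rw [dualVec_add, dotProduct_add, ← Complex.exp_add]
    push_cast
    ring_nf

theorem dualChar_apply {n : ℕ} (A : Matrix (Fin n) (Fin n) ℝ) (z m : Fin n → ℤ) :
    dualChar A z m = Complex.exp (2 * π * I * (((fun i => (z i : ℝ)) ⬝ᵥ dualVec A m : ℝ) : ℂ)) :=
  rfl

theorem exp_two_pi_I_mul_ofReal_eq_one_iff (r : ℝ) :
    Complex.exp (2 * π * I * (r : ℂ)) = 1 ↔ ∃ k : ℤ, r = k := by
  rw [Complex.exp_eq_one_iff]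
  refine exists_congr fun k => ?_
  rw [mul_comm, mul_left_inj' Complex.two_pi_I_ne_zero]
  norm_cast

theorem dualChar_mulVec {n : ℕ} (B : Matrix (Fin n) (Fin n) ℤ)
    (hB : IsUnit (B.map (Int.cast : ℤ → ℝ)).det) (z w : Fin n → ℤ) :
    dualChar (B.map (Int.cast : ℤ → ℝ)) z (B *ᵥ w) = 1 := by
  rw [dualChar_apply, dualVec_mulVec B hB, exp_two_pi_I_mul_ofReal_eq_one_iff]
  exact ⟨z ⬝ᵥ w, by simp [dotProduct]⟩

theorem dualChar_eq_one_iff {n : ℕ} (B : Matrix (Fin n) (Fin n) ℤ)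
    (hB : IsUnit (B.map (Int.cast : ℤ → ℝ)).det) (z : Fin n → ℤ) :
    (∀ m, dualChar (B.map (Int.cast : ℤ → ℝ)) z m = 1) ↔ ∃ k, k ᵥ* B = z := by
  set A := B.map (Int.cast : ℤ → ℝ) with hA
  have hcast : ∀ k : Fin n → ℤ, (fun i => ((k ᵥ* B) i : ℝ)) = (fun i => (k i : ℝ)) ᵥ* A := fun k => by
    ext i
    simp [hA, Matrix.vecMul, dotProduct]
  simp_rw [dualChar_apply, exp_two_pi_I_mul_ofReal_eq_one_iff]
  constructor
  · intro h
    choose k hk using fun i => h (Pi.single i 1)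
    refine ⟨k, ?_⟩
    have hz : (fun i => (z i : ℝ)) = ((fun i => (z i : ℝ)) ᵥ* A⁻¹) ᵥ* A := by
      rw [Matrix.vecMul_vecMul, Matrix.nonsing_inv_mul _ hB, Matrix.vecMul_one]
    have hk' : (fun i => (k i : ℝ)) = (fun i => (z i : ℝ)) ᵥ* A⁻¹ := by
      ext i
      rw [← hk, hz, dotProduct_dualVec A hB, ← hz]
      simp [dotProduct, Pi.single_apply]
    have := hcast k
    rw [hk', ← hz] at this
    ext i
    exact_mod_cast congrFun this i
  · rintro ⟨k, rfl⟩ m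
    rw [hcast, dotProduct_dualVec A hB]
    exact ⟨k ⬝ᵥ m, by simp [dotProduct]⟩

theorem card_quotient_range_mulVec {n : ℕ} (B : Matrix (Fin n) (Fin n) ℤ)
    (hB : Function.Injective B.mulVecLin) :
    Nat.card ((Fin n → ℤ) ⧸ (B.mulVecLin.toAddMonoidHom).range) = B.det.natAbs := by
  have h := Submodule.natAbs_det_equiv B.mulVecLin.range (LinearEquiv.ofInjective B.mulVecLin hB)
  rw [show B.mulVecLin.range.subtype ∘ₗ AddMonoidHom.toIntLinearMap
      (LinearEquiv.ofInjective B.mulVecLin hB : (Fin n → ℤ) →+ B.mulVecLin.range) =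
        Matrix.toLin' B from rfl, LinearMap.det_toLin'] at h
  rw [h]
  rfl

theorem besselI_lattice_sum_of_intMatrix {n : ℕ} (B : Matrix (Fin n) (Fin n) ℤ)
    (hA : IsUnit (B.map (Int.cast : ℤ → ℝ)).det) (t : Fin n → ℂ) (x : Fin n → ℤ) (y : Fin n → ℝ) :
    ∑' k : Fin n → ℤ, (∏ j, besselI ((x + k ᵥ* B) j : ℤ) (t j)) *
        Complex.exp (2 * π * I * ∑ j, ((x + k ᵥ* B) j : ℂ) * (y j : ℂ)) =
    ((|B.det| : ℤ) : ℂ)⁻¹ *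
      ∑' m : Fin n → ℤ,
        (∏ j, (rect (y j - dualVec (B.map (Int.cast : ℤ → ℝ)) m j) : ℂ) *
            Complex.exp (t j *
              Real.cos (2 * π * (y j - dualVec (B.map (Int.cast : ℤ → ℝ)) m j)))) *
          dualChar (B.map (Int.cast : ℤ → ℝ)) x m := by
  classical
  set A := B.map (Int.cast : ℤ → ℝ) with hA'
  have hdet : B.det ≠ 0 := by
    rintro h
    have : A.det = (B.det : ℝ) := ((Int.castRingHom ℝ).map_det B).symm
    rw [h, Int.cast_zero] at this
    exact hA.ne_zero this
  have hinj : Function.Injective B.mulVecLin := Matrix.mulVec_injective_of_det_ne_zero hdet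
  have hinj' : Function.Injective fun k : Fin n → ℤ => x + k ᵥ* B := by
    simp_rw [← Matrix.mulVec_transpose]
    exact (add_right_injective x).comp
      (Matrix.mulVec_injective_of_det_ne_zero (by rwa [Matrix.det_transpose]))
  set L : (Fin n → ℤ) →+ (Fin n → ℤ) := B.mulVecLin.toAddMonoidHom
  have hcard : Nat.card ((Fin n → ℤ) ⧸ L.range) = B.det.natAbs := card_quotient_range_mulVec B hinj
  have : Finite ((Fin n → ℤ) ⧸ L.range) :=
    Nat.finite_of_card_ne_zero (by rw [hcard]; exact Int.natAbs_ne_zero.2 hdet)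
  have := Fintype.ofFinite ((Fin n → ℤ) ⧸ L.range)
  set F : (Fin n → ℤ) → ℂ := fun z => (∏ j, besselI (z j) (t j)) *
    Complex.exp (2 * π * I * ∑ j, (z j : ℂ) * (y j : ℂ))
  set P : (Fin n → ℤ) → ℂ := fun m =>
    (∏ j, Complex.exp (t j * Real.cos (2 * π * (y j - dualVec A m j)))) * dualChar A x m
  have hR := hasSum_of_quotient L hinj (a := fun q => P q.out)
    (f := fun m => (∏ j, (rect (y j - dualVec A m j) : ℂ) *
      Complex.exp (t j * Real.cos (2 * π * (y j - dualVec A m j)))) * dualChar A x m) fun q => by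
    refine ((hasSum_prod_rect_mul_exp t fun j => y j - dualVec A q.out j).mul_right
      (dualChar A x q.out)).congr_fun fun w => ?_
    have h1 : dualVec A (q.out + L w) = fun j => dualVec A q.out j + w j := by
      rw [dualVec_add]
      exact congrArg (dualVec A q.out + ·) (dualVec_mulVec B hA w)
    have h2 : dualChar A x (q.out + L w) = dualChar A x q.out := by
      rw [AddChar.map_add_eq_mul]
      exact (congrArg _ (dualChar_mulVec B hA x w)).trans (mul_one _)
    simp only [h1, h2, sub_sub]
  have hL : ∀ m, HasSum (fun z => F z * dualChar A (x - z) m) (P m) := fun m => by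
    refine ((hasSum_prod_besselI_mul_exp t fun j => y j - dualVec A m j).mul_right
      (dualChar A x m)).congr_fun fun z => ?_
    have e : Complex.exp (2 * π * I * ∑ j, (z j : ℂ) * (y j : ℂ)) * dualChar A (x - z) m =
        Complex.exp (2 * π * I * ∑ j, (z j : ℂ) * ((y j - dualVec A m j : ℝ) : ℂ)) *
          dualChar A x m := by
      rw [dualChar_apply, dualChar_apply, ← Complex.exp_add, ← Complex.exp_add, ← mul_add,
        ← mul_add]
      simp only [dotProduct]
      push_cast
      simp only [← Finset.sum_add_distrib]
      congr 2
      refine Finset.sum_congr rfl fun j _ => ?_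
      simp
      ring
    linear_combination (∏ j, besselI (z j) (t j)) * e
  have hS := hasSum_sum fun (q : (Fin n → ℤ) ⧸ L.range) (_ : q ∈ Finset.univ) => hL q.out
  have hS' : HasSum (fun z => F z * if ∃ k, k ᵥ* B = x - z then (B.det.natAbs : ℂ) else 0)
      (∑ q : (Fin n → ℤ) ⧸ L.range, P q.out) := by
    refine hS.congr_fun fun z => ?_
    rw [← Finset.mul_sum, sum_addChar_out L.range (dualChar A (x - z)), hcard]
    · simp only [dualChar_eq_one_iff B hA, hA']
    · rintro _ ⟨w, rfl⟩
      exact dualChar_mulVec B hA _ w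
  rw [← hinj'.hasSum_iff] at hS'
  · rw [hR.tsum_eq, ← hS'.tsum_eq]
    have hd : ((|B.det| : ℤ) : ℂ) = (B.det.natAbs : ℂ) := by
      rw [Int.abs_eq_natAbs, Int.cast_natCast]
    have hk : ∀ k, ∃ k', k' ᵥ* B = x - (x + k ᵥ* B) := fun k => ⟨-k, by
      rw [Matrix.neg_vecMul]; abel⟩
    simp only [Function.comp_def, if_pos (hk _)]
    have hne : (B.det.natAbs : ℂ) ≠ 0 := by exact_mod_cast Int.natAbs_ne_zero.2 hdet
    rw [tsum_mul_right, hd, eq_inv_mul_iff_mul_eq₀ hne]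
    exact mul_comm _ _
  · intro z hz
    rw [if_neg, mul_zero]
    rintro ⟨k, hk⟩
    exact hz ⟨-k, by simp only [Matrix.neg_vecMul, hk]; abel⟩

/-- for a sublattice `Γ = ℤ^n A ⊆ ℤ^n`, all `t ∈ ℂ^n`, `x ∈ ℤ^n`, `y ∈ ℝ^n`:
`Σ_{γ∈Γ} (∏_j I_{x_j+γ_j}(t_j)) e^{2πi⟨y,x+γ⟩}
 = (1/vol(ℝ^n/Γ)) Σ_{γ*∈Γ*} (∏_j 1_{[-1/2,1/2]}(y_j−γ*_j) e^{t_j cos 2π(y_j−γ*_j)}) e^{2πi⟨x,γ*⟩}`,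
where `Γ* = ℤ^n ᵗA⁻¹` and `vol(ℝ^n/Γ) = |det A|`. -/
theorem besselI_lattice_sum (n : ℕ) (A : Matrix (Fin n) (Fin n) ℝ) (hA : IsUnit A.det)
    (hAint : ∀ i j, ∃ z : ℤ, A i j = (z : ℝ))
    (t : Fin n → ℂ) (x : Fin n → ℤ) (y : Fin n → ℝ) :
    ∑' k : Fin n → ℤ,
      (∏ j, besselI ((x j : ℝ) + ((fun i => (k i : ℝ)) ᵥ* A) j) (t j)) *
        Complex.exp (2 * Real.pi * I *
          ∑ j, (y j : ℂ) * (((x j : ℝ) + ((fun i => (k i : ℝ)) ᵥ* A) j : ℝ) : ℂ)) =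
    ((|A.det| : ℝ) : ℂ)⁻¹ *
      ∑' m : Fin n → ℤ,
        (∏ j, (rect (y j - ((fun i => (m i : ℝ)) ᵥ* (Aᵀ)⁻¹) j) : ℂ) *
            Complex.exp (t j * Real.cos (2 * Real.pi * (y j - ((fun i => (m i : ℝ)) ᵥ* (Aᵀ)⁻¹) j)))) *
          Complex.exp (2 * Real.pi * I *
            ∑ j, (x j : ℂ) * (((fun i => (m i : ℝ)) ᵥ* (Aᵀ)⁻¹) j : ℂ)) := by
  choose B hB using hAint
  obtain rfl : A = (Matrix.of B).map (Int.cast : ℤ → ℝ) := by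
    ext i j
    exact hB i j
  set C := Matrix.of B
  have h := besselI_lattice_sum_of_intMatrix C hA t x y
  have hdet : (C.map (Int.cast : ℤ → ℝ)).det = (C.det : ℝ) := ((Int.castRingHom ℝ).map_det C).symm
  have hcast : ∀ (k : Fin n → ℤ) (j : Fin n),
      (x j : ℝ) + ((fun i => (k i : ℝ)) ᵥ* C.map (Int.cast : ℤ → ℝ)) j =
        (((x + k ᵥ* C) j : ℤ) : ℝ) := fun k j => by
    simp [Matrix.vecMul, dotProduct]
  rw [hdet]
  simp only [hcast]
  convert h using 3
  · congr 3
    refine Finset.sum_congr rfl fun j _ => ?_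
    rw [Complex.ofReal_intCast, mul_comm]
  · rw [← Int.cast_abs, Complex.ofReal_intCast]
  · ext m
    rw [dualChar_apply]
    simp [dotProduct, dualVec]
end
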